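/- The orbit–matrix bijections for type B restrict to the refined setting: the assignment (V,V') ↦ A with a_{ij} = dim_{F_q}((V_{i−1}+V_i∩V'_j)/(V_{i−1}+V_i∩V'_{j−1})) induces a bijection from the set of O(D)-orbits on ιX × ιX (diagonal action) onto ιΞ_d, and the assignment (V,F) ↦ B with b_{ij} = dim_{F_q}((V_{i−1}+V_i∩F_j)/(V_{i−1}+V_i∩F_{j−1})) induces a bijection from the set of O(D)-orbits on ιX × Y onto ιΠ. -/

import Mathlib

noncomputable section

open Module

/-- The orthogonal complement of a subspace `W` with respect to a bilinear form `Q`. -/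
def orthB {F M : Type} [Field F] [AddCommGroup M] [Module F M]
    (Q : M →ₗ[F] M →ₗ[F] F) (W : Submodule F M) : Submodule F M where
  carrier := {u | ∀ w ∈ W, Q u w = 0}
  add_mem' := by
    intro a b ha hb w hw
    simp [map_add, LinearMap.add_apply, ha w hw, hb w hw]
  zero_mem' := by
    intro w hw
    simp
  smul_mem' := by
    intro c a ha w hw
    simp [map_smul, LinearMap.smul_apply, smul_eq_mul, ha w hw]

/-- `g` belongs to the isometry group of `Q` (the orthogonal group `O(D)`). -/
def inIsom {F M : Type} [Field F] [AddCommGroup M] [Module F M]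
    (Q : M →ₗ[F] M →ₗ[F] F) (g : M ≃ₗ[F] M) : Prop :=
  ∀ u u', Q (g u) (g u') = Q u u'

/-- `V` is a point of `X`: an `N`-step flag (`N = 2n+1`) in `𝔽_q^D` (`D = 2d+1`) with
`V_i = V_{N−i}^⊥` for all `i`. -/
def IsXFlag (n d : ℕ) (F : Type) [Field F]
    (Q : (Fin (2*d+1) → F) →ₗ[F] (Fin (2*d+1) → F) →ₗ[F] F)
    (V : Fin (2*n+1+1) → Submodule F (Fin (2*d+1) → F)) : Prop :=
  Monotone V ∧ V 0 = ⊥ ∧ V (Fin.last (2*n+1)) = ⊤ ∧ ∀ i, V i = orthB Q (V i.rev)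

/-- `V` is a point of `ιX ⊆ X`: in addition `V_n` is maximal isotropic
(i.e. `dim V_n = d`). -/
def IsIotaXFlag (n d : ℕ) (F : Type) [Field F]
    (Q : (Fin (2*d+1) → F) →ₗ[F] (Fin (2*d+1) → F) →ₗ[F] F)
    (V : Fin (2*n+1+1) → Submodule F (Fin (2*d+1) → F)) : Prop :=
  IsXFlag n d F Q V ∧ finrank F (V ⟨n, by omega⟩) = d

/-- `Fl` is a point of `Y`: a complete flag with `Fl_i = Fl_{D−i}^⊥`. -/
def IsYFlag (d : ℕ) (F : Type) [Field F]
    (Q : (Fin (2*d+1) → F) →ₗ[F] (Fin (2*d+1) → F) →ₗ[F] F)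
    (Fl : Fin (2*d+1+1) → Submodule F (Fin (2*d+1) → F)) : Prop :=
  Monotone Fl ∧ Fl 0 = ⊥ ∧ Fl (Fin.last (2*d+1)) = ⊤
    ∧ (∀ i, finrank F (Fl i) = (i : ℕ)) ∧ ∀ i, Fl i = orthB Q (Fl i.rev)

/-- The `N×N` matrix associated to a pair of `N`-step flags. -/
def matXX (n d : ℕ) (F : Type) [Field F]
    (V V' : Fin (2*n+1+1) → Submodule F (Fin (2*d+1) → F)) :
    Matrix (Fin (2*n+1)) (Fin (2*n+1)) ℕ :=
  fun i j => finrank F ↥(V i.castSucc ⊔ V i.succ ⊓ V' j.succ)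
    - finrank F ↥(V i.castSucc ⊔ V i.succ ⊓ V' j.castSucc)

/-- The `N×D` matrix associated to a pair consisting of an `N`-step flag and a
complete flag. -/
def matXY (n d : ℕ) (F : Type) [Field F]
    (V : Fin (2*n+1+1) → Submodule F (Fin (2*d+1) → F))
    (Fl : Fin (2*d+1+1) → Submodule F (Fin (2*d+1) → F)) :
    Matrix (Fin (2*n+1)) (Fin (2*d+1)) ℕ :=
  fun i j => finrank F ↥(V i.castSucc ⊔ V i.succ ⊓ Fl j.succ)
    - finrank F ↥(V i.castSucc ⊔ V i.succ ⊓ Fl j.castSucc)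

/-- Membership in `ιΞ_d`: `A ∈ Ξ_d` and the `(n+1)`st row and column vanish except for
the entry `a_{n+1,n+1} = 1`. -/
def memIotaXi (n d : ℕ) (A : Matrix (Fin (2*n+1)) (Fin (2*n+1)) ℕ) : Prop :=
  ((∑ i, ∑ j, A i j) = 2*d+1 ∧ ∀ i j, A i j = A i.rev j.rev)
    ∧ A ⟨n, by omega⟩ ⟨n, by omega⟩ = 1
    ∧ ∀ j : Fin (2*n+1), j ≠ ⟨n, by omega⟩ →
        A ⟨n, by omega⟩ j = 0 ∧ A j ⟨n, by omega⟩ = 0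

/-- Membership in `ιΠ`: `B ∈ Π` and the `(n+1)`st row and `(d+1)`st column vanish except
for the entry `b_{n+1,d+1} = 1`. -/
def memIotaPi (n d : ℕ) (B : Matrix (Fin (2*n+1)) (Fin (2*d+1)) ℕ) : Prop :=
  ((∀ j, ∑ i, B i j = 1) ∧ ∀ i j, B i j = B i.rev j.rev)
    ∧ B ⟨n, by omega⟩ ⟨d, by omega⟩ = 1
    ∧ (∀ j : Fin (2*d+1), j ≠ ⟨d, by omega⟩ → B ⟨n, by omega⟩ j = 0)
    ∧ (∀ i : Fin (2*n+1), i ≠ ⟨n, by omega⟩ → B i ⟨d, by omega⟩ = 0)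

section HyperbolicPairs

variable {F M : Type} [Field F] [AddCommGroup M] [Module F M]

theorem mem_orthB {Q : M →ₗ[F] M →ₗ[F] F} {W : Submodule F M} {u : M} :
    u ∈ orthB Q W ↔ ∀ w ∈ W, Q u w = 0 := Iff.rfl

/-- `Q` is a nondegenerate symmetric bilinear form. -/
structure IsNondegSymm (Q : M →ₗ[F] M →ₗ[F] F) : Prop where
  symm : ∀ x y, Q x y = Q y x
  nondeg : ∀ x, (∀ y, Q x y = 0) → x = 0

/-- `e` and `f` are isotropic vectors with `Q e f = 1`. -/
structure IsHypPair (Q : M →ₗ[F] M →ₗ[F] F) (e f : M) : Prop where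
  left : Q e e = 0
  right : Q f f = 0
  pair : Q e f = 1

/-- The orthogonal complement of a pair of vectors. -/
def pairPerp (Q : M →ₗ[F] M →ₗ[F] F) (e f : M) : Submodule F M :=
  LinearMap.ker ((Q e).prod (Q f))

theorem mem_pairPerp {Q : M →ₗ[F] M →ₗ[F] F} {e f x : M} :
    x ∈ pairPerp Q e f ↔ Q e x = 0 ∧ Q f x = 0 := by
  simp [pairPerp]

/-- The restriction of `Q` to the orthogonal complement of a pair of vectors. -/
def pairPerpForm (Q : M →ₗ[F] M →ₗ[F] F) (e f : M) :
    pairPerp Q e f →ₗ[F] pairPerp Q e f →ₗ[F] F :=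
  Q.domRestrict₁₂ (pairPerp Q e f) (pairPerp Q e f)

@[simp] theorem pairPerpForm_apply (Q : M →ₗ[F] M →ₗ[F] F) (e f : M) (x y : pairPerp Q e f) :
    pairPerpForm Q e f x y = Q x y := rfl

/-- The component orthogonal to a hyperbolic pair. -/
def pairProj (Q : M →ₗ[F] M →ₗ[F] F) (e f x : M) : M := x - Q f x • e - Q e x • f

theorem exists_ne_zero_of_pairPerp [FiniteDimensional F M] (Q : M →ₗ[F] M →ₗ[F] F) (e f : M)
    (h : 3 ≤ finrank F M) : ∃ x, x ≠ 0 ∧ Q e x = 0 ∧ Q f x = 0 := by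
  have h1 := LinearMap.finrank_range_add_finrank_ker ((Q e).prod (Q f))
  have h2 : finrank F (LinearMap.range ((Q e).prod (Q f))) ≤ 2 := by
    simpa using Submodule.finrank_le (LinearMap.range ((Q e).prod (Q f)))
  have h3 : 0 < finrank F (pairPerp Q e f) := by
    unfold pairPerp
    omega
  have : Nontrivial (pairPerp Q e f) := Module.nontrivial_of_finrank_pos h3
  obtain ⟨x, hx⟩ := exists_ne (0 : pairPerp Q e f)
  exact ⟨x, by simpa using hx, mem_pairPerp.1 x.2⟩

namespace IsHypPair

variable {Q : M →ₗ[F] M →ₗ[F] F} {e f : M}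

theorem pairProj_mem (h : IsHypPair Q e f) (hQ : IsNondegSymm Q) (x : M) :
    pairProj Q e f x ∈ pairPerp Q e f := by
  have h3 : Q f e = 1 := by rw [hQ.symm, h.pair]
  rw [mem_pairPerp]
  simp [pairProj, h.left, h.right, h.pair, h3]

theorem apply_pairProj (hQ : IsNondegSymm Q) {x : M} (hx : x ∈ pairPerp Q e f)
    (y : M) : Q x (pairProj Q e f y) = Q x y := by
  rw [mem_pairPerp] at hx
  simp [pairProj, hQ.symm x e, hQ.symm x f, hx.1, hx.2]

theorem isNondegSymm_pairPerpForm (h : IsHypPair Q e f) (hQ : IsNondegSymm Q) :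
    IsNondegSymm (pairPerpForm Q e f) where
  symm x y := hQ.symm _ _
  nondeg x hx := by
    refine Subtype.ext (hQ.nondeg _ fun y => ?_)
    rw [← apply_pairProj hQ x.2]
    exact hx ⟨_, h.pairProj_mem hQ y⟩

theorem finrank_pairPerp [FiniteDimensional F M] (h : IsHypPair Q e f) (hQ : IsNondegSymm Q) :
    finrank F (pairPerp Q e f) + 2 = finrank F M := by
  have h1 := LinearMap.finrank_range_add_finrank_ker ((Q e).prod (Q f))
  have h3 : Q f e = 1 := by rw [hQ.symm, h.pair]
  have h2 : LinearMap.range ((Q e).prod (Q f)) = ⊤ := by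
    rw [LinearMap.range_eq_top]
    rintro ⟨a, b⟩
    exact ⟨a • f + b • e, by simp [h.left, h.right, h.pair, h3]⟩
  rw [h2, finrank_top, finrank_prod, finrank_self] at h1
  unfold pairPerp
  omega

end IsHypPair

/-- A nonisotropic pairing with an isotropic vector can be corrected to a hyperbolic pair inside
every subspace which contains the vectors involved. -/
theorem exists_isHypPair {Q : M →ₗ[F] M →ₗ[F] F} (hQ : IsNondegSymm Q) (h2 : (2 : F) ≠ 0)
    {e f₀ : M} (he : Q e e = 0) (hf : Q e f₀ ≠ 0) :
    ∃ f, IsHypPair Q e f ∧ ∀ W : Submodule F M, f₀ ∈ W → (e ∈ W ∨ Q f₀ f₀ = 0) → f ∈ W := by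
  have hf' : Q f₀ e ≠ 0 := by rwa [hQ.symm]
  refine ⟨(Q e f₀)⁻¹ • f₀ - (Q f₀ f₀ * (Q e f₀)⁻¹ * (Q e f₀)⁻¹ / 2) • e, ⟨he, ?_, ?_⟩, ?_⟩
  · simp [he, hQ.symm f₀ e]
    field_simp
    ring
  · simp [he, hf]
  · rintro W hW (h | h)
    · exact W.sub_mem (W.smul_mem _ hW) (W.smul_mem _ h)
    · simpa [h] using W.smul_mem _ hW

end HyperbolicPairs

section Frames

variable {F M κ : Type} [Field F] [AddCommGroup M] [Module F M]

/-- The involution of the index set of a frame exchanging the two halves. -/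
def frameInv : Option (κ ⊕ κ) → Option (κ ⊕ κ) := Option.map Sum.swap

@[simp] theorem frameInv_frameInv (x : Option (κ ⊕ κ)) : frameInv (frameInv x) = x := by
  rcases x with _ | _ | _ <;> rfl

theorem frameInv_involutive : Function.Involutive (frameInv (κ := κ)) := frameInv_frameInv

/-- The nonzero Gram entries of a frame. -/
def frameWt (c : F) : Option (κ ⊕ κ) → F
  | none => c
  | some _ => 1

open Classical in
/-- A family of vectors consisting of pairwise orthogonal hyperbolic pairs and one further vector
of square length `c`. -/
def IsFrame (Q : M →ₗ[F] M →ₗ[F] F) (c : F) (w : Option (κ ⊕ κ) → M) : Prop :=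
  ∀ x y, Q (w x) (w y) = if y = frameInv x then frameWt c x else 0

/-- Extend a family by a pair of vectors. -/
def extendFrame {α : Type} (e f : α) (w : Option (κ ⊕ κ) → α) :
    Option (Option κ ⊕ Option κ) → α
  | none => w none
  | some (Sum.inl none) => e
  | some (Sum.inr none) => f
  | some (Sum.inl (some k)) => w (some (Sum.inl k))
  | some (Sum.inr (some k)) => w (some (Sum.inr k))

theorem IsFrame.extend {Q : M →ₗ[F] M →ₗ[F] F} (hQ : IsNondegSymm Q) {e f : M}
    (h : IsHypPair Q e f) {c : F} {w : Option (κ ⊕ κ) → pairPerp Q e f}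
    (hw : IsFrame (pairPerpForm Q e f) c w) :
    IsFrame Q c (extendFrame e f fun x => (w x : M)) := by
  classical
  have h1 : ∀ x, Q e (w x) = 0 := fun x => (mem_pairPerp.1 (w x).2).1
  have h2 : ∀ x, Q f (w x) = 0 := fun x => (mem_pairPerp.1 (w x).2).2
  have h3 : ∀ x, Q (w x) e = 0 := fun x => by rw [hQ.symm, h1]
  have h4 : ∀ x, Q (w x) f = 0 := fun x => by rw [hQ.symm, h2]
  have h5 : Q f e = 1 := by rw [hQ.symm, h.pair]
  have h6 : ∀ x y, Q (w x) (w y) = if y = frameInv x then frameWt c x else 0 :=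
    fun x y => by simpa using hw x y
  rintro (_ | (_ | _) | (_ | _)) (_ | (_ | _) | (_ | _)) <;>
    simp [extendFrame, frameInv, frameWt, h1, h2, h3, h4, h5, h6, h.left, h.right, h.pair]

theorem isFrame_of_isEmpty [IsEmpty κ] (Q : M →ₗ[F] M →ₗ[F] F) (v : M) :
    IsFrame Q (Q v v) (fun _ : Option (κ ⊕ κ) => v) := by
  rintro (_ | k | k) (_ | l | l) <;>
    first | exact isEmptyElim k | exact isEmptyElim l | simp [frameInv, frameWt]

end Frames

section ExistsFrame

variable {F : Type} [Field F]

theorem two_ne_zero_of_odd_card [Fintype F] (h : Odd (Fintype.card F)) : (2 : F) ≠ 0 := by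
  refine Ring.two_ne_zero fun h' => ?_
  have := FiniteField.even_card_of_char_two h'
  rw [Nat.odd_iff] at h
  omega

theorem exists_isotropic [Fintype F] (h : Odd (Fintype.card F)) {M : Type} [AddCommGroup M]
    [Module F M] [FiniteDimensional F M] {Q : M →ₗ[F] M →ₗ[F] F} (hQ : IsNondegSymm Q)
    (hM : 3 ≤ finrank F M) : ∃ e, e ≠ 0 ∧ Q e e = 0 := by
  by_contra! hno
  obtain ⟨x, hx, -⟩ := exists_ne_zero_of_pairPerp Q 0 0 hM
  obtain ⟨y, hy, hxy, -⟩ := exists_ne_zero_of_pairPerp Q x x hM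
  obtain ⟨z, hz, hxz, hyz⟩ := exists_ne_zero_of_pairPerp Q x y hM
  obtain ⟨a, b, hab⟩ := FiniteField.exists_root_sum_quadratic
    (f := Polynomial.C (Q y y) * Polynomial.X ^ 2 + Polynomial.C 0 * Polynomial.X
      + Polynomial.C 0)
    (g := Polynomial.C (Q z z) * Polynomial.X ^ 2 + Polynomial.C 0 * Polynomial.X
      + Polynomial.C (Q x x))
    (Polynomial.degree_quadratic (hno y hy)) (Polynomial.degree_quadratic (hno z hz))
    (Nat.odd_iff.1 h)
  refine hno (x + a • y + b • z) (fun h0 => hno x hx ?_) ?_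
  · have := congrArg (Q x) h0
    simpa [hxy, hxz] using this
  · simp [hQ.symm y x, hQ.symm z x, hQ.symm z y, hxy, hxz, hyz] at hab ⊢
    linear_combination hab

theorem exists_isFrame [Fintype F] (h : Odd (Fintype.card F)) (r : ℕ) :
    ∀ {M : Type} [AddCommGroup M] [Module F M] [FiniteDimensional F M] {Q : M →ₗ[F] M →ₗ[F] F},
      IsNondegSymm Q → finrank F M = 2 * r + 1 →
      ∃ (κ : Type) (_ : Fintype κ) (c : F) (w : Option (κ ⊕ κ) → M), c ≠ 0 ∧ IsFrame Q c w ∧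
        Fintype.card κ = r := by
  induction r with
  | zero =>
    intro M _ _ _ Q hQ hM
    obtain ⟨v, hv, hv'⟩ := finrank_eq_one_iff'.1 hM
    refine ⟨Empty, inferInstance, Q v v, fun _ => v, fun h0 => hv (hQ.nondeg v fun y => ?_),
      isFrame_of_isEmpty Q v, rfl⟩
    obtain ⟨t, rfl⟩ := hv' y
    simp [h0]
  | succ r ih =>
    intro M _ _ _ Q hQ hM
    obtain ⟨e, he, hee⟩ := exists_isotropic h hQ (by omega)
    obtain ⟨f₀, hf₀⟩ : ∃ f₀, Q e f₀ ≠ 0 := by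
      by_contra! h0
      exact he (hQ.nondeg e h0)
    obtain ⟨f, hef, -⟩ := exists_isHypPair hQ (two_ne_zero_of_odd_card h) hee hf₀
    have h1 := hef.finrank_pairPerp hQ
    obtain ⟨κ, _, c, w, hc, hw, hr⟩ := ih (hef.isNondegSymm_pairPerpForm hQ) (by omega)
    exact ⟨Option κ, inferInstance, c, _, hc, hw.extend hQ hef, by simp [hr]⟩

end ExistsFrame

section SelfDualFlags

variable {F M : Type} [Field F] [AddCommGroup M] [Module F M]

/-- A flag with `2 * n + 1` steps with `V_i = V_{2n+1-i}^⊥` such that `V_{n+1} / V_n` is at most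
one-dimensional. -/
structure IsDualFlag (Q : M →ₗ[F] M →ₗ[F] F) (n : ℕ)
    (V : Fin (2 * n + 1 + 1) → Submodule F M) : Prop where
  mono : Monotone V
  zero : V 0 = ⊥
  last : V (Fin.last (2 * n + 1)) = ⊤
  dual : ∀ i, V i = orthB Q (V i.rev)
  mid : ∀ x ∈ V ⟨n + 1, by omega⟩, x ∉ V ⟨n, by omega⟩ →
    ∀ y ∈ V ⟨n + 1, by omega⟩, ∃ t : F, y - t • x ∈ V ⟨n, by omega⟩

namespace IsDualFlag

variable {Q : M →ₗ[F] M →ₗ[F] F} {n : ℕ} {V : Fin (2 * n + 1 + 1) → Submodule F M}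

theorem apply_eq_zero (hV : IsDualFlag Q n V) {i j : Fin (2 * n + 1 + 1)} (hij : j ≤ i.rev)
    {x y : M} (hx : x ∈ V i) (hy : y ∈ V j) : Q x y = 0 := by
  rw [hV.dual] at hx
  exact hx y (hV.mono hij hy)

theorem castSucc_eq_orthB (hV : IsDualFlag Q n V) (p : Fin (2 * n + 1)) :
    V p.castSucc = orthB Q (V p.rev.succ) := by
  rw [hV.dual, Fin.rev_castSucc]

theorem pairProj_mem (hQ : IsNondegSymm Q) (hV : IsDualFlag Q n V) {e f : M}
    {p : Fin (2 * n + 1)} (he : e ∈ V p.succ) (hf : f ∈ V p.rev.succ) {a : Fin (2 * n + 1 + 1)}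
    {x : M} (hx : x ∈ V a) : pairProj Q e f x ∈ V a := by
  have key : ∀ (p : Fin (2 * n + 1)) (e f : M), e ∈ V p.succ → f ∈ V p.rev.succ →
      Q f x • e ∈ V a := by
    intro p e f he hf
    rcases le_or_gt p.succ a with h | h
    · exact (V a).smul_mem _ (hV.mono h he)
    · have h1 : x ∈ V p.castSucc := hV.mono (Fin.le_castSucc_iff.2 h) hx
      rw [hV.castSucc_eq_orthB] at h1
      rw [hQ.symm, h1 f hf]
      simp
  refine (V a).sub_mem ((V a).sub_mem hx (key p e f he hf)) (key p.rev f e hf ?_)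
  rwa [Fin.rev_rev]

/-- The flag induced on the orthogonal complement of a compatible hyperbolic pair. -/
theorem restrict (hQ : IsNondegSymm Q) (hV : IsDualFlag Q n V) {e f : M} (h : IsHypPair Q e f)
    {p : Fin (2 * n + 1)} (he : e ∈ V p.succ) (hf : f ∈ V p.rev.succ) :
    IsDualFlag (pairPerpForm Q e f) n fun a => (V a).comap (pairPerp Q e f).subtype where
  mono a b hab := Submodule.comap_mono (hV.mono hab)
  zero := by simp [hV.zero]
  last := by simp [hV.last]
  dual a := by
    ext x
    simp only [Submodule.mem_comap, mem_orthB, pairPerpForm_apply]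
    refine ⟨fun hx y hy => hV.apply_eq_zero le_rfl hx hy, fun hx => ?_⟩
    rw [hV.dual]
    intro y hy
    change Q (x : M) y = 0
    rw [← IsHypPair.apply_pairProj hQ x.2]
    exact hx ⟨_, h.pairProj_mem hQ y⟩ (hV.pairProj_mem hQ he hf hy)
  mid x hx hxn y hy := hV.mid x hx hxn y hy

/-- A vector first appearing in step `p` of a flag has a hyperbolic partner in step `rev p`. -/
theorem exists_partner (hV : IsDualFlag Q n V) {e : M}
    {p : Fin (2 * n + 1)} (he' : e ∉ V p.castSucc) :
    ∃ f ∈ V p.rev.succ, Q e f ≠ 0 := by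
  rw [hV.castSucc_eq_orthB] at he'
  by_contra! h
  exact he' h

theorem mem_or_isotropic (hV : IsDualFlag Q n V) {e f : M} {p : Fin (2 * n + 1)}
    (he : e ∈ V p.succ) (hf : f ∈ V p.rev.succ) : e ∈ V p.rev.succ ∨ Q f f = 0 := by
  rcases le_or_gt p p.rev with h | h
  · exact Or.inl (hV.mono (Fin.succ_le_succ_iff.2 h) he)
  · refine Or.inr (hV.apply_eq_zero ?_ hf hf)
    rw [Fin.rev_succ, Fin.rev_rev]
    exact Fin.le_castSucc_iff.2 (Fin.succ_lt_succ_iff.2 h)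

end IsDualFlag

/-- In an increasing family starting at `⊥`, the first nontrivial member. -/
theorem exists_first_ne_bot {N : ℕ} (V : Fin (N + 1) → Submodule F M) (h0 : V 0 = ⊥)
    {a : Fin (N + 1)} (ha : V a ≠ ⊥) :
    ∃ p : Fin N, p.succ ≤ a ∧ V p.castSucc = ⊥ ∧ V p.succ ≠ ⊥ := by
  induction a using Fin.induction with
  | zero => exact absurd h0 ha
  | succ i ih =>
    by_cases h : V i.castSucc = ⊥
    · exact ⟨i, le_rfl, h, ha⟩
    · obtain ⟨p, hp, h1⟩ := ih h
      exact ⟨p, hp.trans (Fin.castSucc_le_succ i), h1⟩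

/-- The extension of a position function on one half of a frame to the whole frame. -/
def frameExt {κ : Type} {n : ℕ} (p : κ → Fin (2 * n + 1)) : Option (κ ⊕ κ) → Fin (2 * n + 1)
  | none => ⟨n, by omega⟩
  | some (Sum.inl k) => p k
  | some (Sum.inr k) => (p k).rev

theorem mem_extendFrame {κ : Type} {n : ℕ} {V : Fin (2 * n + 1 + 1) → Submodule F M}
    {p₀ : Fin (2 * n + 1)} {p : κ → Fin (2 * n + 1)} {e f : M} {w : Option (κ ⊕ κ) → M}
    (he : e ∈ V p₀.succ) (hf : f ∈ V p₀.rev.succ) (hw : ∀ x, w x ∈ V (frameExt p x).succ)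
    (x : Option (Option κ ⊕ Option κ)) :
    extendFrame e f w x ∈ V (frameExt (fun k : Option κ => k.elim p₀ p) x).succ := by
  rcases x with _ | (_ | k) | (_ | k)
  · exact hw none
  · exact he
  · exact hw (some (Sum.inl k))
  · exact hf
  · exact hw (some (Sum.inr k))

theorem exists_adapted_frame (h2 : (2 : F) ≠ 0) {n m : ℕ} (r : ℕ) :
    ∀ {M : Type} [AddCommGroup M] [Module F M] [FiniteDimensional F M] {Q : M →ₗ[F] M →ₗ[F] F}
      {V : Fin (2 * n + 1 + 1) → Submodule F M} {V' : Fin (2 * m + 1 + 1) → Submodule F M},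
      IsNondegSymm Q → finrank F M = 2 * r + 1 → IsDualFlag Q n V → IsDualFlag Q m V' →
      ∃ (κ : Type) (_ : Fintype κ) (c : F) (w : Option (κ ⊕ κ) → M) (p : κ → Fin (2 * n + 1))
        (s : κ → Fin (2 * m + 1)), c ≠ 0 ∧ IsFrame Q c w ∧ Fintype.card κ = r ∧
        (∀ k, (p k : ℕ) < n) ∧ (∀ x, w x ∈ V (frameExt p x).succ) ∧
        (∀ x, w x ∈ V' (frameExt s x).succ) := by
  induction r with
  | zero =>
    intro M _ _ _ Q V V' hQ hM hV hV'
    obtain ⟨v, hv, hv'⟩ := finrank_eq_one_iff'.1 hM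
    have hvv : Q v v ≠ 0 := fun h0 => hv (hQ.nondeg v fun y => by
      obtain ⟨t, rfl⟩ := hv' y
      simp [h0])
    have key : ∀ (l : ℕ) (U : Fin (2 * l + 1 + 1) → Submodule F M), IsDualFlag Q l U →
        v ∈ U (Fin.succ ⟨l, by omega⟩) := by
      intro l U hU
      rw [hU.dual]
      intro y hy
      obtain ⟨t, rfl⟩ := hv' y
      have := hU.apply_eq_zero (by simp [Fin.le_def, Fin.val_rev]; omega) hy hy
      simp only [map_smul, LinearMap.smul_apply, smul_eq_mul] at this ⊢
      simp [hvv] at this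
      simp [this]
    refine ⟨Empty, inferInstance, Q v v, fun _ => v, Empty.elim, Empty.elim, hvv,
      isFrame_of_isEmpty Q v, rfl, fun k => k.elim, ?_, ?_⟩
    · rintro (_ | k | k)
      exacts [key n V hV, k.elim, k.elim]
    · rintro (_ | k | k)
      exacts [key m V' hV', k.elim, k.elim]
  | succ r ih =>
    intro M _ _ _ Q V V' hQ hM hV hV'
    have hn : V ⟨n, by omega⟩ ≠ ⊥ := by
      intro h0
      have h1 : V ⟨n + 1, by omega⟩ = ⊤ := by
        rw [hV.dual]
        have : (⟨n + 1, by omega⟩ : Fin (2 * n + 1 + 1)).rev = ⟨n, by omega⟩ := by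
          ext
          simp [Fin.val_rev]
          omega
        rw [this, h0]
        ext x
        simp [mem_orthB]
      have : Nontrivial M := Module.nontrivial_of_finrank_pos (R := F) (by omega)
      obtain ⟨v, hv⟩ := exists_ne (0 : M)
      have : finrank F M = 1 := by
        refine finrank_eq_one_iff'.2 ⟨v, hv, fun y => ?_⟩
        obtain ⟨t, ht⟩ := hV.mid v (by simp [h1]) (by simpa [h0] using hv) y (by simp [h1])
        rw [h0, Submodule.mem_bot, sub_eq_zero] at ht
        exact ⟨t, ht.symm⟩
      omega
    obtain ⟨p₀, hpn, hp, hp'⟩ := exists_first_ne_bot V hV.zero hn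
    obtain ⟨s₀, -, hs, hs'⟩ := exists_first_ne_bot (fun j => V p₀.succ ⊓ V' j)
      (by simp [hV'.zero]) (a := Fin.last _) (by simpa [hV'.last] using hp')
    obtain ⟨e, ⟨heV, heV'⟩, he⟩ := Submodule.exists_mem_ne_zero_of_ne_bot hs'
    have hpn' : (p₀ : ℕ) < n := by simpa [Fin.le_def] using hpn
    have hee : Q e e = 0 := hV.apply_eq_zero (by simp [Fin.le_def, Fin.val_rev]; omega) heV heV
    have heV₀ : e ∉ V' s₀.castSucc := fun h => he (by
      have : e ∈ V p₀.succ ⊓ V' s₀.castSucc := ⟨heV, h⟩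
      simpa [hs] using this)
    obtain ⟨f₀, hf₀, hef₀⟩ := hV'.exists_partner heV₀
    obtain ⟨f, hef, hf⟩ := exists_isHypPair hQ h2 hee hef₀
    have hfV' : f ∈ V' s₀.rev.succ := hf _ hf₀ (hV'.mem_or_isotropic heV' hf₀)
    have hfV : f ∈ V p₀.rev.succ := by
      rw [hV.dual, Fin.rev_succ, Fin.rev_rev, hp]
      simp [mem_orthB]
    have hr := hef.finrank_pairPerp hQ
    obtain ⟨κ, _, c, w, p, s, hc, hw, hκ, hpn, hwV, hwV'⟩ :=
      ih (hef.isNondegSymm_pairPerpForm hQ) (by omega) (hV.restrict hQ hef heV hfV)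
        (hV'.restrict hQ hef heV' hfV')
    refine ⟨Option κ, inferInstance, c, _, fun k => k.elim p₀ p, fun k => k.elim s₀ s, hc,
      hw.extend hQ hef, by simp [hκ], ?_, mem_extendFrame heV hfV hwV,
      mem_extendFrame heV' hfV' hwV'⟩
    rintro (_ | k)
    exacts [hpn', hpn k]

end SelfDualFlags

section FrameBases

variable {F M κ : Type} [Field F] [AddCommGroup M] [Module F M]
  {Q : M →ₗ[F] M →ₗ[F] F} {c : F} {w : Option (κ ⊕ κ) → M}

theorem frameWt_ne_zero (hc : c ≠ 0) (x : Option (κ ⊕ κ)) : frameWt c x ≠ 0 := by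
  rcases x with _ | x
  exacts [hc, one_ne_zero]

namespace IsFrame

theorem apply_eq [DecidableEq κ] (hw : IsFrame Q c w) (x y : Option (κ ⊕ κ)) :
    Q (w x) (w y) = if y = frameInv x then frameWt c x else 0 := by
  convert hw x y

/-- Rescale the distinguished vector of a frame. -/
theorem rescale {c' t : F} (hw : IsFrame Q c' w) (ht : t ^ 2 * c' = c) :
    IsFrame Q c fun x => frameWt t x • w x := by
  classical
  rintro (_ | _ | _) (_ | _ | _) <;> simp [hw.apply_eq, frameInv, frameWt]
  rw [← ht]
  ring

theorem reindex {κ' : Type} {w' : Option (κ' ⊕ κ') → M} (hw' : IsFrame Q c w') (φ : κ ≃ κ') :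
    IsFrame Q c (w' ∘ Option.map (Sum.map φ φ)) := by
  classical
  rintro (_ | _ | _) (_ | _ | _) <;> simp [hw'.apply_eq, frameInv, frameWt]

variable [Fintype κ]

theorem apply_sum (hw : IsFrame Q c w) (a : Option (κ ⊕ κ) → F) (x : Option (κ ⊕ κ)) :
    Q (w x) (∑ y, a y • w y) = a (frameInv x) * frameWt c x := by
  classical
  simp only [map_sum, map_smul, smul_eq_mul, hw.apply_eq x]
  simp

theorem exists_basis (hw : IsFrame Q c w) (hc : c ≠ 0)
    (hM : finrank F M = 2 * Fintype.card κ + 1) :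
    ∃ b : Basis (Option (κ ⊕ κ)) F M, ⇑b = w := by
  have hli : LinearIndependent F w := by
    refine Fintype.linearIndependent_iff.2 fun a ha x => ?_
    have h1 := hw.apply_sum a (frameInv x)
    rw [ha, map_zero, frameInv_frameInv] at h1
    exact (mul_eq_zero.1 h1.symm).resolve_right (frameWt_ne_zero hc _)
  refine ⟨basisOfLinearIndependentOfCardEqFinrank hli ?_,
    coe_basisOfLinearIndependentOfCardEqFinrank hli _⟩
  rw [hM, Fintype.card_option, Fintype.card_sum]
  omega

theorem det_toMatrix [DecidableEq κ] {b : Basis (Option (κ ⊕ κ)) F M} (hw : IsFrame Q c b) :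
    (LinearMap.toMatrix₂ b b Q).det =
      ((Equiv.Perm.sign (Function.Involutive.toPerm frameInv
        (frameInv_involutive (κ := κ))) : ℤ) : F) * c := by
  have h1 : LinearMap.toMatrix₂ b b Q = (Matrix.diagonal (frameWt c)).submatrix id
      (Function.Involutive.toPerm frameInv (frameInv_involutive (κ := κ))) := by
    ext x y
    rw [LinearMap.toMatrix₂_apply, hw.apply_eq x y, Matrix.submatrix_apply, Matrix.diagonal_apply]
    refine if_congr ?_ rfl rfl
    rw [id, Function.Involutive.coe_toPerm]
    constructor <;> rintro h <;> simp [h]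
  rw [h1, Matrix.det_permute', Matrix.det_diagonal, Fintype.prod_option]
  simp [frameWt]

/-- The square lengths of the distinguished vectors of two frames agree up to a square. -/
theorem exists_sq_mul_eq {w' : Option (κ ⊕ κ) → M} {c' : F} (hw : IsFrame Q c w)
    (hw' : IsFrame Q c' w') (hc : c ≠ 0) (hc' : c' ≠ 0)
    (hM : finrank F M = 2 * Fintype.card κ + 1) : ∃ t, t ^ 2 * c' = c := by
  classical
  obtain ⟨b, rfl⟩ := hw.exists_basis hc hM
  obtain ⟨b', rfl⟩ := hw'.exists_basis hc' hM
  have h1 := congrArg Matrix.det (LinearMap.toMatrix₂_mul_basis_toMatrix b' b' b b Q)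
  rw [Matrix.det_mul, Matrix.det_mul, Matrix.det_transpose, hw.det_toMatrix,
    hw'.det_toMatrix] at h1
  set u := Equiv.Perm.sign (Function.Involutive.toPerm frameInv (frameInv_involutive (κ := κ)))
  have hu : ((u : ℤ) : F) * ((u : ℤ) : F) = 1 := by
    rw [← Int.cast_mul, ← Units.val_mul, Int.units_mul_self]
    simp
  refine ⟨(b'.toMatrix b).det, ?_⟩
  linear_combination ((u : ℤ) : F) * h1 + (c - (b'.toMatrix b).det ^ 2 * c') * hu

end IsFrame

end FrameBases

section FrameFlags

variable {F M ι : Type} [Field F] [AddCommGroup M] [Module F M]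

/-- The flag spanned by a family of vectors with prescribed positions. -/
def spanFlag {N : ℕ} (w : ι → M) (P : ι → Fin N) (a : Fin (N + 1)) : Submodule F M :=
  Submodule.span F (w '' {x | (P x).castSucc < a})

/-- The matrix of relative positions of two flags. -/
def flagMatrix {N N' : ℕ} (V : Fin (N + 1) → Submodule F M) (V' : Fin (N' + 1) → Submodule F M) :
    Matrix (Fin N) (Fin N') ℕ :=
  fun i j => finrank F ↥(V i.castSucc ⊔ V i.succ ⊓ V' j.succ)
    - finrank F ↥(V i.castSucc ⊔ V i.succ ⊓ V' j.castSucc)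

theorem span_image_inf_span_image (b : Basis ι F M) (S T : Set ι) :
    Submodule.span F (b '' S) ⊓ Submodule.span F (b '' T) = Submodule.span F (b '' (S ∩ T)) := by
  ext x
  simp [Basis.mem_span_image, Submodule.mem_inf, Set.subset_inter_iff]

theorem finrank_span_image (b : Basis ι F M) (S : Finset ι) :
    finrank F (Submodule.span F (b '' (S : Set ι))) = S.card := by
  classical
  have h1 : LinearIndependent F fun x : S => b x := b.linearIndependent.comp _ Subtype.val_injective
  have h2 := finrank_span_eq_card h1
  rw [Fintype.card_coe] at h2
  have h3 : Set.range (fun x : S => b x) = b '' (S : Set ι) := by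
    ext x
    simp [Set.mem_image]
  rw [← h2, h3]

variable [Fintype ι] {N N' : ℕ} {P : ι → Fin N} {S : ι → Fin N'}

theorem finrank_spanFlag (b : Basis ι F M) (a : Fin (N + 1)) :
    finrank F (spanFlag (F := F) b P a) = Finset.card {x | (P x).castSucc < a} := by
  rw [← finrank_span_image b, Finset.coe_filter_univ]
  rfl

theorem flagMatrix_spanFlag (b : Basis ι F M) (i : Fin N) (j : Fin N') :
    flagMatrix (spanFlag (F := F) b P) (spanFlag b S) i j =
      Finset.card {x | P x = i ∧ S x = j} := by
  classical
  have key : ∀ a : Fin (N' + 1), finrank F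
      ↥(spanFlag (F := F) b P i.castSucc ⊔ spanFlag (F := F) b P i.succ ⊓ spanFlag b S a) =
      Finset.card {x | P x < i ∨ (P x ≤ i ∧ (S x).castSucc < a)} := by
    intro a
    unfold spanFlag
    rw [span_image_inf_span_image, ← Submodule.span_union, ← Set.image_union,
      ← finrank_span_image b, Finset.coe_filter_univ]
    have hset : {x | (P x).castSucc < i.castSucc} ∪
        ({x | (P x).castSucc < i.succ} ∩ {x | (S x).castSucc < a}) =
        {x | P x < i ∨ (P x ≤ i ∧ (S x).castSucc < a)} := by
      ext x
      simp only [Set.mem_union, Set.mem_inter_iff, Set.mem_ofPred_eq,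
        Fin.lt_def, Fin.le_def, Fin.val_castSucc, Fin.val_succ]
      omega
    rw [hset]
  rw [flagMatrix, key, key, ← Finset.card_sdiff_of_subset]
  · congr 1
    ext x
    simp only [Finset.mem_sdiff, Finset.mem_filter_univ, Fin.ext_iff, Fin.lt_def, Fin.le_def,
      Fin.val_castSucc, Fin.val_succ]
    omega
  · intro x
    simp only [Finset.mem_filter_univ, Fin.lt_def, Fin.le_def, Fin.val_castSucc, Fin.val_succ]
    omega

end FrameFlags

section FrameDuality

variable {F M κ : Type} [Field F] [AddCommGroup M] [Module F M]
  {Q : M →ₗ[F] M →ₗ[F] F} {c : F} {n : ℕ}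

theorem frameExt_frameInv (p : κ → Fin (2 * n + 1)) (x : Option (κ ⊕ κ)) :
    frameExt p (frameInv x) = (frameExt p x).rev := by
  rcases x with _ | _ | _
  · ext
    simp [frameExt, frameInv, Fin.val_rev]
    omega
  · rfl
  · simp [frameExt, frameInv]

theorem orthB_spanFlag [Fintype κ] {b : Basis (Option (κ ⊕ κ)) F M} (hb : IsFrame Q c b)
    (hc : c ≠ 0) (hQ : IsNondegSymm Q) (p : κ → Fin (2 * n + 1)) (a : Fin (2 * n + 1 + 1)) :
    orthB Q (spanFlag (F := F) b (frameExt p) a) = spanFlag b (frameExt p) a.rev := by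
  classical
  have hrev : ∀ x, (frameExt p (frameInv x)).castSucc < a.rev ↔ ¬ (frameExt p x).castSucc < a := by
    intro x
    rw [frameExt_frameInv]
    simp [Fin.lt_def, Fin.val_rev]
    omega
  apply le_antisymm
  · intro y hy
    rw [spanFlag, Basis.mem_span_image]
    intro z hz
    obtain ⟨x, rfl⟩ : ∃ x, z = frameInv x := ⟨frameInv z, by simp⟩
    refine (hrev x).2 fun hx => ?_
    have h1 := hy _ (Submodule.subset_span ⟨x, hx, rfl⟩)
    have h2 := hb.apply_sum (b.repr y) x
    rw [b.sum_repr, hQ.symm, h1] at h2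
    have h3 := (mul_eq_zero.1 h2.symm).resolve_right (frameWt_ne_zero hc _)
    simp [h3] at hz
  · rw [spanFlag, Submodule.span_le]
    rintro _ ⟨y, hy, rfl⟩ z hz
    have : spanFlag (F := F) b (frameExt p) a ≤ LinearMap.ker (Q (b y)) := by
      rw [spanFlag, Submodule.span_le]
      rintro _ ⟨x, hx, rfl⟩
      rw [SetLike.mem_coe, LinearMap.mem_ker, hQ.symm, hb x y, if_neg]
      rintro rfl
      exact (hrev x).1 hy hx
    exact this hz

/-- A self-dual flag compatible with a frame is spanned by parts of the frame. -/
theorem IsDualFlag.eq_spanFlag [Fintype κ]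
    {V : Fin (2 * n + 1 + 1) → Submodule F M} (hV : IsDualFlag Q n V) (hQ : IsNondegSymm Q)
    {b : Basis (Option (κ ⊕ κ)) F M} (hb : IsFrame Q c b) (hc : c ≠ 0)
    {p : κ → Fin (2 * n + 1)} (h : ∀ x, b x ∈ V (frameExt p x).succ) :
    V = spanFlag b (frameExt p) := by
  have hle : ∀ a, spanFlag b (frameExt p) a ≤ V a := by
    intro a
    rw [spanFlag, Submodule.span_le]
    rintro _ ⟨x, hx, rfl⟩
    exact hV.mono (Fin.castSucc_lt_iff_succ_le.1 hx) (h x)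
  funext a
  refine le_antisymm ?_ (hle a)
  intro y hy
  rw [hV.dual] at hy
  have : y ∈ orthB Q (spanFlag b (frameExt p) a.rev) := fun z hz => hy z (hle _ hz)
  rwa [orthB_spanFlag hb hc hQ, Fin.rev_rev] at this

theorem isDualFlag_of_finrank [FiniteDimensional F M] (hQ : IsNondegSymm Q) {d : ℕ}
    (hM : finrank F M = 2 * d + 1) {V : Fin (2 * n + 1 + 1) → Submodule F M} (h1 : Monotone V)
    (h2 : V 0 = ⊥) (h3 : V (Fin.last (2 * n + 1)) = ⊤) (h4 : ∀ i, V i = orthB Q (V i.rev))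
    (h5 : finrank F (V ⟨n, by omega⟩) = d) : IsDualFlag Q n V := by
  refine ⟨h1, h2, h3, h4, fun x hx hxn y hy => ?_⟩
  have h6 : finrank F (V ⟨n + 1, by omega⟩) = d + 1 := by
    have hrev : (⟨n + 1, by omega⟩ : Fin (2 * n + 1 + 1)).rev = ⟨n, by omega⟩ := by
      ext
      simp [Fin.val_rev]
      omega
    have h7 : V ⟨n + 1, by omega⟩ = LinearMap.BilinForm.orthogonal Q (V ⟨n, by omega⟩) := by
      rw [h4, hrev]
      ext z
      simp only [mem_orthB, LinearMap.BilinForm.mem_orthogonal_iff]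
      exact forall₂_congr fun w _ => by rw [hQ.symm]
    have h8 : LinearMap.BilinForm.Nondegenerate Q :=
      ⟨hQ.nondeg, fun z hz => hQ.nondeg z fun w => by rw [hQ.symm, hz]⟩
    rw [h7, LinearMap.BilinForm.finrank_orthogonal h8, hM, h5]
    omega
  have h7 : V ⟨n, by omega⟩ ⊔ Submodule.span F {x} = V ⟨n + 1, by omega⟩ := by
    refine Submodule.eq_of_le_of_finrank_le (sup_le (h1 ?_) ?_) ?_
    · simp [Fin.le_def]
    · simpa using hx
    · rw [h6, ← h5]
      refine Submodule.finrank_lt_finrank_of_lt (lt_of_le_of_ne le_sup_left fun h => hxn ?_)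
      rw [h]
      exact Submodule.mem_sup_right (Submodule.mem_span_singleton_self x)
  rw [← h7, Submodule.mem_sup] at hy
  obtain ⟨z, hz, z', hz', rfl⟩ := hy
  obtain ⟨t, rfl⟩ := Submodule.mem_span_singleton.1 hz'
  exact ⟨t, by simpa using hz⟩

end FrameDuality

section Counting

variable {κ : Type} {n m d : ℕ}

/-- Membership in the set of centrally symmetric matrices with entry sum `2 * d + 1` whose middle
row and column vanish outside the central entry, which is `1`. -/
structure IsIotaMatrix (n m d : ℕ) (A : Matrix (Fin (2 * n + 1)) (Fin (2 * m + 1)) ℕ) : Prop where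
  sum : ∑ i, ∑ j, A i j = 2 * d + 1
  symm : ∀ i j, A i j = A i.rev j.rev
  mid : A ⟨n, by omega⟩ ⟨m, by omega⟩ = 1
  row : ∀ j, j ≠ ⟨m, by omega⟩ → A ⟨n, by omega⟩ j = 0
  col : ∀ i, i ≠ ⟨n, by omega⟩ → A i ⟨m, by omega⟩ = 0

theorem sum_eq_two_mul_add_mid (R : Fin (2 * n + 1) → ℕ) (hR : ∀ i, R i = R i.rev) :
    ∑ i, R i = 2 * ∑ i with i.val < n, R i + R ⟨n, by omega⟩ := by
  have h1 := Finset.sum_filter_add_sum_filter_not Finset.univ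
    (fun i : Fin (2 * n + 1) => i.val < n) R
  have h2 : ({i : Fin (2 * n + 1) | ¬ i.val < n} : Finset _) =
      insert ⟨n, by omega⟩ ({i : Fin (2 * n + 1) | n < i.val} : Finset _) := by
    ext i
    simp only [Finset.mem_filter_univ, Finset.mem_insert, Fin.ext_iff]
    omega
  have h3 : ∑ i : Fin (2 * n + 1) with n < i.val, R i = ∑ i with i.val < n, R i := by
    refine Finset.sum_nbij' Fin.rev Fin.rev ?_ ?_ ?_ ?_ ?_
    · intro i
      simp only [Finset.mem_filter_univ, Fin.val_rev]
      omega
    · intro i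
      simp only [Finset.mem_filter_univ, Fin.val_rev]
      omega
    · simp
    · simp
    · exact fun i _ => hR i
  rw [h2, Finset.sum_insert (by simp), h3] at h1
  omega

theorem IsIotaMatrix.sum_half {A : Matrix (Fin (2 * n + 1)) (Fin (2 * m + 1)) ℕ}
    (hA : IsIotaMatrix n m d A) : ∑ i with i.val < n, ∑ j, A i j = d := by
  have h1 := sum_eq_two_mul_add_mid (fun i => ∑ j, A i j) fun i => by
    rw [← Equiv.sum_comp Fin.revPerm]
    exact Finset.sum_congr rfl fun j _ => by simp [hA.symm i]
  have h2 : ∑ j, A ⟨n, by omega⟩ j = 1 := by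
    rw [Finset.sum_eq_single ⟨m, by omega⟩ (fun j _ hj => hA.row j hj) (by simp), hA.mid]
  have h3 := hA.sum
  simp only [h2] at h1
  omega

theorem IsIotaMatrix.ext_half {A B : Matrix (Fin (2 * n + 1)) (Fin (2 * m + 1)) ℕ}
    (hA : IsIotaMatrix n m d A) (hB : IsIotaMatrix n m d B)
    (h : ∀ i j, i.val < n → A i j = B i j) : A = B := by
  ext i j
  rcases lt_trichotomy i.val n with hi | hi | hi
  · exact h i j hi
  · have hi' : i = ⟨n, by omega⟩ := Fin.ext hi
    rw [hi']
    by_cases hj : j = ⟨m, by omega⟩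
    · rw [hj, hA.mid, hB.mid]
    · rw [hA.row j hj, hB.row j hj]
  · rw [hA.symm, hB.symm]
    refine h _ _ ?_
    rw [Fin.val_rev]
    omega

theorem frameExt_eq_mid_iff {p : κ → Fin (2 * n + 1)} (hp : ∀ k, p k ≠ ⟨n, by omega⟩)
    (x : Option (κ ⊕ κ)) : frameExt p x = ⟨n, by omega⟩ ↔ x = none := by
  rcases x with _ | k | k
  · simp [frameExt]
  · simp [frameExt, hp]
  · have := hp k
    simp only [frameExt, ne_eq, Fin.ext_iff, Fin.val_rev, reduceCtorEq, iff_false] at this ⊢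
    omega

variable [Fintype κ]

theorem card_frameExt (s : κ → Fin (2 * m + 1)) :
    2 * Finset.card {x | (frameExt s x).castSucc < ⟨m, by omega⟩} +
      Finset.card {x | frameExt s x = ⟨m, by omega⟩} = 2 * Fintype.card κ + 1 := by
  have h1 := sum_eq_two_mul_add_mid (fun j => Finset.card {x | frameExt s x = j}) fun j => by
    refine Finset.card_nbij' frameInv frameInv ?_ ?_ (by simp [Set.LeftInvOn])
      (by simp [Set.RightInvOn, Set.LeftInvOn]) <;>
      simp [Set.MapsTo, frameExt_frameInv, Fin.rev_eq_iff]
  have h2 : ∑ j, Finset.card {x | frameExt s x = j} = 2 * Fintype.card κ + 1 := by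
    rw [← Finset.card_eq_sum_card_fiberwise (by simp [Set.MapsTo]), Finset.card_univ,
      Fintype.card_option, Fintype.card_sum]
    omega
  have h3 : Finset.card {x | (frameExt s x).castSucc < ⟨m, by omega⟩} =
      ∑ j with j.val < m, Finset.card {x | frameExt s x = j} := by
    rw [Finset.card_eq_sum_card_fiberwise (f := frameExt s) (t := {j | j.val < m})]
    · refine Finset.sum_congr rfl fun j hj => ?_
      congr 1
      ext x
      simp only [Finset.mem_filter, Finset.mem_univ, true_and, Fin.lt_def, Fin.val_castSucc,
        and_iff_right_iff_imp] at hj ⊢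
      rintro rfl
      exact hj
    · intro x
      simp [Fin.lt_def]
  omega

theorem card_frameExt_lt {s : κ → Fin (2 * m + 1)} (hs : ∀ k, s k ≠ ⟨m, by omega⟩) :
    Finset.card {x | (frameExt s x).castSucc < ⟨m, by omega⟩} = Fintype.card κ := by
  have h1 := card_frameExt s
  simp only [frameExt_eq_mid_iff hs] at h1
  have h2 : Finset.card {x : Option (κ ⊕ κ) | x = none} = 1 :=
    Finset.card_eq_one.2 ⟨none, by ext; simp⟩
  omega

theorem ne_mid_of_card {s : κ → Fin (2 * m + 1)}
    (h : Finset.card {x | (frameExt s x).castSucc < ⟨m, by omega⟩} = Fintype.card κ) (k : κ) :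
    s k ≠ ⟨m, by omega⟩ := by
  intro hk
  have h1 := card_frameExt s
  have h2 : Finset.card {x | frameExt s x = ⟨m, by omega⟩} = 1 := by omega
  have h3 := Finset.card_le_one.1 h2.le none (Finset.mem_filter_univ _ |>.2 rfl)
    (some (Sum.inl k)) (Finset.mem_filter_univ _ |>.2 hk)
  cases h3

/-- The matrix counting the elements with given positions. -/
def countMatrix {ι : Type} [Fintype ι] {N N' : ℕ} (P : ι → Fin N) (S : ι → Fin N') :
    Matrix (Fin N) (Fin N') ℕ :=
  fun i j => Finset.card {x | P x = i ∧ S x = j}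

theorem isIotaMatrix_countMatrix {p : κ → Fin (2 * n + 1)} {s : κ → Fin (2 * m + 1)}
    (hp : ∀ k, p k ≠ ⟨n, by omega⟩) (hs : ∀ k, s k ≠ ⟨m, by omega⟩) :
    IsIotaMatrix n m (Fintype.card κ) (countMatrix (frameExt p) (frameExt s)) where
  sum := by
    have h1 := Finset.card_eq_sum_card_fiberwise (s := Finset.univ)
      (t := (Finset.univ : Finset (Fin (2 * n + 1) × Fin (2 * m + 1))))
      (f := fun x : Option (κ ⊕ κ) => (frameExt p x, frameExt s x)) (by simp [Set.MapsTo])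
    rw [Finset.card_univ, Fintype.card_option, Fintype.card_sum] at h1
    simp only [Prod.ext_iff] at h1
    rw [← Fintype.sum_prod_type' fun i j => countMatrix (frameExt p) (frameExt s) i j]
    unfold countMatrix
    omega
  symm i j := by
    refine Finset.card_nbij' frameInv frameInv ?_ ?_ (by simp [Set.LeftInvOn])
      (by simp [Set.RightInvOn, Set.LeftInvOn]) <;>
      simp +contextual [Set.MapsTo, frameExt_frameInv]
  mid := by
    simp only [countMatrix, frameExt_eq_mid_iff hp, frameExt_eq_mid_iff hs]
    exact Finset.card_eq_one.2 ⟨none, by ext; simp⟩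
  row j hj := by
    simp only [countMatrix, frameExt_eq_mid_iff hp, Finset.card_eq_zero, Finset.filter_eq_empty_iff]
    rintro x - ⟨rfl, rfl⟩
    exact hj rfl
  col i hi := by
    simp only [countMatrix, frameExt_eq_mid_iff hs, Finset.card_eq_zero, Finset.filter_eq_empty_iff]
    rintro x - ⟨rfl, rfl⟩
    exact hi rfl

theorem countMatrix_frameExt {p : κ → Fin (2 * n + 1)} (hp : ∀ k, (p k).val < n)
    (s : κ → Fin (2 * m + 1)) {i : Fin (2 * n + 1)} (hi : i.val < n) (j : Fin (2 * m + 1)) :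
    countMatrix (frameExt p) (frameExt s) i j = countMatrix p s i j := by
  refine (Finset.card_nbij (fun k => some (Sum.inl k)) ?_ ?_ ?_).symm
  · intro k hk
    rw [Finset.coe_filter_univ] at hk ⊢
    exact hk
  · intro k _ l _ h
    simpa using h
  · rintro (_ | k | k) hx
    · simp only [Finset.coe_filter_univ, Set.mem_ofPred_eq, frameExt, Fin.ext_iff] at hx
      omega
    · exact ⟨k, by rwa [Finset.coe_filter_univ] at hx ⊢, rfl⟩
    · have := hp k
      simp only [Finset.coe_filter_univ, Set.mem_ofPred_eq, frameExt, Fin.ext_iff,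
        Fin.val_rev] at hx
      omega

/-- Two functions whose fibres have the same cardinalities differ by a bijection. -/
theorem exists_equiv_of_card_fiber {α β γ : Type} [Fintype α] [Fintype β] [DecidableEq γ]
    (f : α → γ) (g : β → γ)
    (h : ∀ y, Finset.card {x | f x = y} = Finset.card {x | g x = y}) :
    ∃ φ : α ≃ β, ∀ x, g (φ x) = f x := by
  have h1 : ∀ y, Nonempty ({x // f x = y} ≃ {x // g x = y}) := fun y =>
    ⟨Fintype.equivOfCardEq (by rw [Fintype.card_subtype, Fintype.card_subtype, h])⟩
  let e := fun y => (h1 y).some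
  exact ⟨(Equiv.sigmaFiberEquiv f).symm.trans
    ((Equiv.sigmaCongrRight e).trans (Equiv.sigmaFiberEquiv g)), fun x => (e (f x) ⟨x, rfl⟩).2⟩

/-- A function with prescribed cardinalities of the fibres. -/
theorem exists_card_fiber_eq {γ : Type} [Fintype γ] [DecidableEq γ] (a : γ → ℕ)
    (h : ∑ y, a y = Fintype.card κ) : ∃ f : κ → γ, ∀ y, Finset.card {x | f x = y} = a y := by
  have e : κ ≃ Σ y, Fin (a y) := Fintype.equivOfCardEq (by simp [h])
  refine ⟨fun x => (e x).1, fun y => ?_⟩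
  rw [← Fintype.card_subtype]
  calc _ = Fintype.card {z : Σ y, Fin (a y) // z.1 = y} :=
        Fintype.card_congr (e.subtypeEquiv fun x => Iff.rfl)
    _ = a y := by rw [Fintype.card_congr (Equiv.sigmaSubtype y)]; simp

end Counting

section IotaFlags

variable {F M : Type} [Field F] [AddCommGroup M] [Module F M] {Q : M →ₗ[F] M →ₗ[F] F} {n m d : ℕ}

/-- `V` is a self-dual flag with `2 * n + 1` steps whose lower middle term has dimension `d`. -/
def IsIotaFlag (Q : M →ₗ[F] M →ₗ[F] F) (n d : ℕ) (V : Fin (2 * n + 1 + 1) → Submodule F M) : Prop :=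
  (Monotone V ∧ V 0 = ⊥ ∧ V (Fin.last (2 * n + 1)) = ⊤ ∧ ∀ i, V i = orthB Q (V i.rev)) ∧
    finrank F (V ⟨n, by omega⟩) = d

theorem isIotaFlag_spanFlag {κ : Type} [Fintype κ] (hQ : IsNondegSymm Q) {c : F}
    {b : Basis (Option (κ ⊕ κ)) F M} (hb : IsFrame Q c b) (hc : c ≠ 0)
    {p : κ → Fin (2 * n + 1)} (hp : ∀ k, p k ≠ ⟨n, by omega⟩) :
    IsIotaFlag Q n (Fintype.card κ) (spanFlag b (frameExt p)) := by
  refine ⟨⟨fun a a' h => ?_, ?_, ?_, fun a => ?_⟩, ?_⟩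
  · exact Submodule.span_mono (Set.image_mono fun x hx => lt_of_lt_of_le hx h)
  · simp [spanFlag]
  · simp [spanFlag, Fin.castSucc_lt_last]
  · rw [orthB_spanFlag hb hc hQ, Fin.rev_rev]
  · rw [finrank_spanFlag, card_frameExt_lt hp]

theorem flagMatrix_spanFlag_eq_countMatrix {ι : Type} [Fintype ι] {N N' : ℕ} {P : ι → Fin N}
    {S : ι → Fin N'} (b : Basis ι F M) :
    flagMatrix (spanFlag (F := F) b P) (spanFlag b S) = countMatrix P S := by
  ext i j
  exact flagMatrix_spanFlag b i j

variable {V W : Fin (2 * n + 1 + 1) → Submodule F M} {V' W' : Fin (2 * m + 1 + 1) → Submodule F M}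

theorem IsIotaFlag.isDualFlag (hV : IsIotaFlag Q n d V) (hQ : IsNondegSymm Q)
    (hM : finrank F M = 2 * d + 1) : IsDualFlag Q n V :=
  have : FiniteDimensional F M := Module.finite_of_finrank_pos (by omega)
  isDualFlag_of_finrank hQ hM hV.1.1 hV.1.2.1 hV.1.2.2.1 hV.1.2.2.2 hV.2

/-- Two self-dual flags are simultaneously spanned by parts of a frame. -/
theorem IsIotaFlag.exists_frame (h2 : (2 : F) ≠ 0) (hQ : IsNondegSymm Q)
    (hM : finrank F M = 2 * d + 1) (hV : IsIotaFlag Q n d V) (hV' : IsIotaFlag Q m d V') :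
    ∃ (κ : Type) (_ : Fintype κ) (c : F) (b : Basis (Option (κ ⊕ κ)) F M)
      (p : κ → Fin (2 * n + 1)) (s : κ → Fin (2 * m + 1)), c ≠ 0 ∧ IsFrame Q c b ∧
      Fintype.card κ = d ∧ (∀ k, (p k).val < n) ∧ (∀ k, s k ≠ ⟨m, by omega⟩) ∧
      V = spanFlag b (frameExt p) ∧ V' = spanFlag b (frameExt s) := by
  have : FiniteDimensional F M := Module.finite_of_finrank_pos (by omega)
  obtain ⟨κ, _, c, w, p, s, hc, hw, rfl, hp, hwV, hwV'⟩ := exists_adapted_frame h2 d hQ hM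
    (hV.isDualFlag hQ hM) (hV'.isDualFlag hQ hM)
  obtain ⟨b, rfl⟩ := hw.exists_basis hc hM
  have h3 := (hV'.isDualFlag hQ hM).eq_spanFlag hQ hw hc hwV'
  refine ⟨κ, _, c, b, p, s, hc, hw, rfl, hp, ne_mid_of_card ?_,
    (hV.isDualFlag hQ hM).eq_spanFlag hQ hw hc hwV, h3⟩
  rw [← finrank_spanFlag b, ← h3, hV'.2]

theorem ne_mid_of_lt {κ : Type} {p : κ → Fin (2 * n + 1)} (hp : ∀ k, (p k).val < n) (k : κ) :
    p k ≠ ⟨n, by omega⟩ := fun h => (hp k).ne (Fin.ext_iff.1 h)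

theorem IsIotaFlag.isIotaMatrix (h2 : (2 : F) ≠ 0) (hQ : IsNondegSymm Q)
    (hM : finrank F M = 2 * d + 1) (hV : IsIotaFlag Q n d V) (hV' : IsIotaFlag Q m d V') :
    IsIotaMatrix n m d (flagMatrix V V') := by
  obtain ⟨κ, _, c, b, p, s, hc, hb, rfl, hp, hs, rfl, rfl⟩ := hV.exists_frame h2 hQ hM hV'
  rw [flagMatrix_spanFlag_eq_countMatrix]
  exact isIotaMatrix_countMatrix (ne_mid_of_lt hp) hs

/-- Every matrix of the expected shape is the matrix of a pair of flags. -/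
theorem IsIotaMatrix.exists_flags [Fintype F] (hodd : Odd (Fintype.card F)) (hQ : IsNondegSymm Q)
    (hM : finrank F M = 2 * d + 1) {A : Matrix (Fin (2 * n + 1)) (Fin (2 * m + 1)) ℕ}
    (hA : IsIotaMatrix n m d A) :
    ∃ V V', IsIotaFlag Q n d V ∧ IsIotaFlag Q m d V' ∧ flagMatrix V V' = A := by
  have : FiniteDimensional F M := Module.finite_of_finrank_pos (by omega)
  obtain ⟨κ, _, c, w, hc, hw, rfl⟩ := exists_isFrame hodd d hQ hM
  obtain ⟨b, rfl⟩ := hw.exists_basis hc hM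
  obtain ⟨f, hf⟩ := exists_card_fiber_eq (κ := κ)
    (fun y : Fin (2 * n + 1) × Fin (2 * m + 1) => if y.1.val < n then A y.1 y.2 else 0) (by
      rw [Fintype.sum_prod_type, ← hA.sum_half, Finset.sum_filter]
      refine Finset.sum_congr rfl fun i _ => ?_
      split_ifs <;> simp)
  have hf' : ∀ k, (if (f k).1.val < n then A (f k).1 (f k).2 else 0) ≠ 0 := fun k h => by
    have h1 := (hf (f k)).trans h
    rw [Finset.card_eq_zero, Finset.filter_eq_empty_iff] at h1
    exact h1 (Finset.mem_univ k) rfl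
  have hp : ∀ k, (f k).1.val < n := fun k => by
    by_contra h
    exact hf' k (if_neg h)
  have hs : ∀ k, (f k).2 ≠ ⟨m, by omega⟩ := fun k h => by
    have h1 := hf' k
    rw [if_pos (hp k), h] at h1
    exact h1 (hA.col _ (ne_mid_of_lt hp k))
  refine ⟨spanFlag b (frameExt fun k => (f k).1), spanFlag b (frameExt fun k => (f k).2),
    isIotaFlag_spanFlag hQ hw hc (ne_mid_of_lt hp), isIotaFlag_spanFlag hQ hw hc hs, ?_⟩
  rw [flagMatrix_spanFlag_eq_countMatrix]
  refine (isIotaMatrix_countMatrix (ne_mid_of_lt hp) hs).ext_half hA fun i j hi => ?_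
  have h1 := hf (i, j)
  rw [if_pos hi] at h1
  rw [countMatrix_frameExt hp _ hi, ← h1]
  simp only [countMatrix, Prod.ext_iff]

/-- Pairs of self-dual flags with the same matrix are related by an isometry. -/
theorem IsIotaFlag.exists_isometry (h2 : (2 : F) ≠ 0) (hQ : IsNondegSymm Q)
    (hM : finrank F M = 2 * d + 1) (hV : IsIotaFlag Q n d V) (hV' : IsIotaFlag Q m d V')
    (hW : IsIotaFlag Q n d W) (hW' : IsIotaFlag Q m d W')
    (h : flagMatrix V V' = flagMatrix W W') :
    ∃ g : M ≃ₗ[F] M, inIsom Q g ∧ (∀ i, (V i).map (g : M →ₗ[F] M) = W i) ∧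
      ∀ i, (V' i).map (g : M →ₗ[F] M) = W' i := by
  have hdW := hW.isDualFlag hQ hM
  have hdW' := hW'.isDualFlag hQ hM
  obtain ⟨κ, _, c, b, p, s, hc, hb, rfl, hp, hs, rfl, rfl⟩ := hV.exists_frame h2 hQ hM hV'
  obtain ⟨κ', _, c', b', p', s', hc', hb', -, hp', hs', hWb, hWb'⟩ := hW.exists_frame h2 hQ hM hW'
  rw [hWb, hWb', flagMatrix_spanFlag_eq_countMatrix, flagMatrix_spanFlag_eq_countMatrix] at h
  obtain ⟨φ, hφ⟩ := exists_equiv_of_card_fiber (fun k => (p k, s k)) (fun k => (p' k, s' k)) (by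
    rintro ⟨i, j⟩
    simp only [Prod.ext_iff]
    by_cases hi : i.val < n
    · have h1 := congrFun (congrFun h i) j
      rwa [countMatrix_frameExt hp _ hi, countMatrix_frameExt hp' _ hi] at h1
    · rw [Finset.filter_false_of_mem, Finset.filter_false_of_mem, Finset.card_empty,
        Finset.card_empty]
      · rintro k - ⟨rfl, -⟩
        exact hi (hp' k)
      · rintro k - ⟨rfl, -⟩
        exact hi (hp k))
  simp only [Prod.ext_iff] at hφ
  obtain ⟨t, ht⟩ := hb.exists_sq_mul_eq (hb'.reindex φ) hc hc' hM
  have hpos : ∀ {N : ℕ} (q : κ' → Fin (2 * N + 1)) (r : κ → Fin (2 * N + 1))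
      (_ : ∀ k, q (φ k) = r k) (x : Option (κ ⊕ κ)),
      frameExt q (Option.map (Sum.map φ φ) x) = frameExt r x := by
    rintro N q r hqr (_ | k | k)
    · rfl
    · exact hqr k
    · exact congrArg Fin.rev (hqr k)
  have hb'' := (hb'.reindex φ).rescale ht
  obtain ⟨b'', hbb⟩ := hb''.exists_basis hc hM
  rw [← hbb] at hb''
  have hmem : ∀ {N : ℕ} (q : κ' → Fin (2 * N + 1)) (r : κ → Fin (2 * N + 1))
      (_ : ∀ k, q (φ k) = r k) (x : Option (κ ⊕ κ)),
      b'' x ∈ spanFlag (F := F) b' (frameExt q) (frameExt r x).succ := by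
    intro N q r hqr x
    rw [hbb]
    refine Submodule.smul_mem _ _ (Submodule.subset_span ⟨_, ?_, rfl⟩)
    rw [Set.mem_ofPred_eq, hpos q r hqr]
    exact Fin.castSucc_lt_succ
  have h3 := hdW.eq_spanFlag hQ hb'' hc (p := p) fun x => by
    rw [hWb]
    exact hmem p' p (fun k => (hφ k).1) x
  have h4 := hdW'.eq_spanFlag hQ hb'' hc (p := s) fun x => by
    rw [hWb']
    exact hmem s' s (fun k => (hφ k).2) x
  have hmap : ∀ {N : ℕ} (P : Option (κ ⊕ κ) → Fin N) (a : Fin (N + 1)),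
      (spanFlag (F := F) b P a).map (b.equiv b'' (Equiv.refl _) : M →ₗ[F] M) =
        spanFlag b'' P a := by
    intro N P a
    rw [spanFlag, Submodule.map_span, spanFlag, ← Set.image_comp]
    congr 2
    ext x
    simp
  refine ⟨b.equiv b'' (Equiv.refl _), ?_, fun i => by rw [h3, hmap], fun i => by rw [h4, hmap]⟩
  have h5 : Q.compl₁₂ (b.equiv b'' (Equiv.refl _) : M →ₗ[F] M)
      (b.equiv b'' (Equiv.refl _) : M →ₗ[F] M) = Q := by
    refine LinearMap.ext_basis b b fun x y => ?_
    classical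
    simp [hb.apply_eq, hb''.apply_eq]
  intro u u'
  exact LinearMap.congr_fun (LinearMap.congr_fun h5 u) u'

theorem flagMatrix_map {N N' : ℕ} (g : M ≃ₗ[F] M) (U : Fin (N + 1) → Submodule F M)
    (U' : Fin (N' + 1) → Submodule F M) :
    flagMatrix (fun i => (U i).map (g : M →ₗ[F] M)) (fun i => (U' i).map (g : M →ₗ[F] M)) =
      flagMatrix U U' := by
  ext i j
  simp only [flagMatrix]
  rw [← Submodule.map_inf _ g.injective, ← Submodule.map_inf _ g.injective, ← Submodule.map_sup,
    ← Submodule.map_sup, LinearEquiv.finrank_map_eq, LinearEquiv.finrank_map_eq]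

theorem IsIotaFlag.flagMatrix_eq_iff (h2 : (2 : F) ≠ 0) (hQ : IsNondegSymm Q)
    (hM : finrank F M = 2 * d + 1) (hV : IsIotaFlag Q n d V) (hV' : IsIotaFlag Q m d V')
    (hW : IsIotaFlag Q n d W) (hW' : IsIotaFlag Q m d W') :
    flagMatrix V V' = flagMatrix W W' ↔
    ∃ g : M ≃ₗ[F] M, inIsom Q g ∧ (∀ i, (V i).map (g : M →ₗ[F] M) = W i) ∧
      ∀ i, (V' i).map (g : M →ₗ[F] M) = W' i := by
  refine ⟨hV.exists_isometry h2 hQ hM hV' hW hW', ?_⟩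
  rintro ⟨g, -, hg, hg'⟩
  rw [← flagMatrix_map g V V', funext hg, funext hg']

/-- The second flag is complete if and only if the column sums of the matrix are `1`. -/
theorem IsIotaFlag.finrank_eq_iff (h2 : (2 : F) ≠ 0) (hQ : IsNondegSymm Q)
    (hM : finrank F M = 2 * d + 1) (hV : IsIotaFlag Q n d V) (hV' : IsIotaFlag Q m d V') :
    (∀ a, finrank F (V' a) = a) ↔ ∀ j, ∑ i, flagMatrix V V' i j = 1 := by
  obtain ⟨κ, _, c, b, p, s, hc, hb, rfl, hp, hs, rfl, rfl⟩ := hV.exists_frame h2 hQ hM hV'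
  have h3 : ∀ j, ∑ i, flagMatrix (spanFlag (F := F) b (frameExt p)) (spanFlag b (frameExt s)) i j =
      Finset.card {x | frameExt s x = j} := by
    intro j
    rw [flagMatrix_spanFlag_eq_countMatrix,
      Finset.card_eq_sum_card_fiberwise (f := frameExt p) (t := Finset.univ) (by simp [Set.MapsTo])]
    simp only [countMatrix, Finset.filter_filter, and_comm]
  have h4 : ∀ j : Fin (2 * m + 1), Finset.card {x | (frameExt s x).castSucc < j.succ} =
      Finset.card {x | (frameExt s x).castSucc < j.castSucc} +
        Finset.card {x | frameExt s x = j} := by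
    classical
    intro j
    rw [← Finset.card_union_of_disjoint]
    · congr 1
      ext x
      simp only [Finset.mem_filter_univ, Finset.mem_union, Fin.lt_def, Fin.val_castSucc,
        Fin.val_succ, Fin.ext_iff]
      omega
    · refine Finset.disjoint_filter.2 fun x _ hx hx' => ?_
      rw [hx'] at hx
      exact lt_irrefl _ hx
  simp only [h3, finrank_spanFlag]
  constructor
  · intro h j
    have h5 := h4 j
    rw [h, h, Fin.val_succ, Fin.val_castSucc] at h5
    omega
  · intro h a
    induction a using Fin.induction with
    | zero => simp
    | succ j ih => rw [h4, ih, h, Fin.val_succ, Fin.val_castSucc]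

end IotaFlags

theorem isYFlag_iff {d : ℕ} {F : Type} [Field F]
    {Q : (Fin (2*d+1) → F) →ₗ[F] (Fin (2*d+1) → F) →ₗ[F] F}
    {Fl : Fin (2*d+1+1) → Submodule F (Fin (2*d+1) → F)} :
    IsYFlag d F Q Fl ↔ IsIotaFlag Q d d Fl ∧ ∀ a, finrank F (Fl a) = a :=
  ⟨fun ⟨h1, h2, h3, h4, h5⟩ => ⟨⟨⟨h1, h2, h3, h5⟩, h4 _⟩, h4⟩,
    fun ⟨⟨⟨h1, h2, h3, h5⟩, _⟩, h4⟩ => ⟨h1, h2, h3, h4, h5⟩⟩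

theorem memIotaXi_iff {n d : ℕ} {A : Matrix (Fin (2*n+1)) (Fin (2*n+1)) ℕ} :
    memIotaXi n d A ↔ IsIotaMatrix n n d A :=
  ⟨fun ⟨⟨h1, h2⟩, h3, h4⟩ => ⟨h1, h2, h3, fun j hj => (h4 j hj).1, fun i hi => (h4 i hi).2⟩,
    fun h => ⟨⟨h.sum, h.symm⟩, h.mid, fun j hj => ⟨h.row j hj, h.col j hj⟩⟩⟩

theorem memIotaPi_iff {n d : ℕ} {B : Matrix (Fin (2*n+1)) (Fin (2*d+1)) ℕ} :
    memIotaPi n d B ↔ IsIotaMatrix n d d B ∧ ∀ j, ∑ i, B i j = 1 := by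
  refine ⟨fun ⟨⟨h1, h2⟩, h3, h4, h5⟩ => ⟨⟨?_, h2, h3, h4, h5⟩, h1⟩,
    fun ⟨h, h1⟩ => ⟨⟨h1, h.symm⟩, h.mid, h.row, h.col⟩⟩
  refine (Finset.sum_comm (f := fun i j => B i j)).trans ?_
  simp [h1]

/-- The orbit–matrix bijections restrict to the refined setting: `(V,V') ↦ A` induces a
bijection `O(D)\(ιX × ιX) ↔ ιΞ_d` and `(V,F) ↦ B` induces a bijection
`O(D)\(ιX × Y) ↔ ιΠ`. -/
theorem stmt13 (n d : ℕ) (hn : 0 < n) (hd : 0 < d)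
    (F : Type) [Field F] [Fintype F] (hodd : Odd (Fintype.card F))
    (Q : (Fin (2*d+1) → F) →ₗ[F] (Fin (2*d+1) → F) →ₗ[F] F)
    (hQsymm : ∀ u u', Q u u' = Q u' u)
    (hQnd : ∀ u, (∀ u', Q u u' = 0) → u = 0) :
    -- (a) the matrix of a pair of flags in `ιX × ιX` lies in `ιΞ_d`
    (∀ V V', IsIotaXFlag n d F Q V → IsIotaXFlag n d F Q V' →
      memIotaXi n d (matXX n d F V V'))
    -- (b) every matrix in `ιΞ_d` arises this way
    ∧ (∀ A : Matrix (Fin (2*n+1)) (Fin (2*n+1)) ℕ, memIotaXi n d A →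
        ∃ V V', IsIotaXFlag n d F Q V ∧ IsIotaXFlag n d F Q V' ∧ matXX n d F V V' = A)
    -- (c) two pairs have the same matrix iff they lie in the same `O(D)`-orbit
    ∧ (∀ V V' W W', IsIotaXFlag n d F Q V → IsIotaXFlag n d F Q V' →
        IsIotaXFlag n d F Q W → IsIotaXFlag n d F Q W' →
        (matXX n d F V V' = matXX n d F W W' ↔
          ∃ g : (Fin (2*d+1) → F) ≃ₗ[F] (Fin (2*d+1) → F), inIsom Q g
            ∧ (∀ i, (V i).map (g : (Fin (2*d+1) → F) →ₗ[F] (Fin (2*d+1) → F)) = W i)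
            ∧ (∀ i, (V' i).map (g : (Fin (2*d+1) → F) →ₗ[F] (Fin (2*d+1) → F)) = W' i)))
    -- (a') the matrix of a pair in `ιX × Y` lies in `ιΠ`
    ∧ (∀ V Fl, IsIotaXFlag n d F Q V → IsYFlag d F Q Fl →
        memIotaPi n d (matXY n d F V Fl))
    -- (b') every matrix in `ιΠ` arises this way
    ∧ (∀ B : Matrix (Fin (2*n+1)) (Fin (2*d+1)) ℕ, memIotaPi n d B →
        ∃ V Fl, IsIotaXFlag n d F Q V ∧ IsYFlag d F Q Fl ∧ matXY n d F V Fl = B)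
    -- (c') fibers of the assignment on `ιX × Y` are exactly the `O(D)`-orbits
    ∧ (∀ V Fl W Gl, IsIotaXFlag n d F Q V → IsYFlag d F Q Fl →
        IsIotaXFlag n d F Q W → IsYFlag d F Q Gl →
        (matXY n d F V Fl = matXY n d F W Gl ↔
          ∃ g : (Fin (2*d+1) → F) ≃ₗ[F] (Fin (2*d+1) → F), inIsom Q g
            ∧ (∀ i, (V i).map (g : (Fin (2*d+1) → F) →ₗ[F] (Fin (2*d+1) → F)) = W i)
            ∧ (∀ i, (Fl i).map (g : (Fin (2*d+1) → F) →ₗ[F] (Fin (2*d+1) → F)) = Gl i))) := by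
  have h2 := two_ne_zero_of_odd_card hodd
  have hQ : IsNondegSymm Q := ⟨hQsymm, hQnd⟩
  have hM : finrank F (Fin (2*d+1) → F) = 2 * d + 1 := by simp
  refine ⟨fun V V' hV hV' => memIotaXi_iff.2 (IsIotaFlag.isIotaMatrix h2 hQ hM hV hV'),
    fun A hA => (memIotaXi_iff.1 hA).exists_flags hodd hQ hM,
    fun V V' W W' hV hV' hW hW' => IsIotaFlag.flagMatrix_eq_iff h2 hQ hM hV hV' hW hW', ?_, ?_, ?_⟩
  · intro V Fl hV hFl
    obtain ⟨hFl, hrank⟩ := isYFlag_iff.1 hFl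
    exact memIotaPi_iff.2 ⟨IsIotaFlag.isIotaMatrix h2 hQ hM hV hFl,
      (IsIotaFlag.finrank_eq_iff h2 hQ hM hV hFl).1 hrank⟩
  · intro B hB
    obtain ⟨hB, hcol⟩ := memIotaPi_iff.1 hB
    obtain ⟨V, Fl, hV, hFl, rfl⟩ := hB.exists_flags hodd hQ hM
    exact ⟨V, Fl, hV, isYFlag_iff.2 ⟨hFl, (hV.finrank_eq_iff h2 hQ hM hFl).2 hcol⟩, rfl⟩
  · intro V Fl W Gl hV hFl hW hGl
    exact IsIotaFlag.flagMatrix_eq_iff h2 hQ hM hV (isYFlag_iff.1 hFl).1 hW (isYFlag_iff.1 hGl).1
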